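/- Suppose γ_s ≤ 1/6 for all s. Then, with the convention a_0 := 0, for every j ≥ 1 and every n ≥ 0 one has lim_{s→∞} a_{j·2^s + n} = a_n. In particular, lim_{s→∞} a_{j·2^s} = 0 for every j ≥ 1, and liminf_{n→∞} a_n = 0. -/

import Mathlib

open Polynomial MeasureTheory Filter

/-- `r γ s` : the recursively defined scales `r 0 = 1`, `r (s+1) = γ (s+1) * (r s)²`. -/
noncomputable def r (γ : ℕ → ℝ) : ℕ → ℝ
  | 0 => 1
  | s + 1 => γ (s + 1) * (r γ s) ^ 2

/-- `P γ s` : the polynomial `P_{2^s}`, with `P_1 = X - 1` and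
`P_{2^{s+1}} = P_{2^s} · (P_{2^s} + r_s)`. -/
noncomputable def P (γ : ℕ → ℝ) : ℕ → Polynomial ℝ
  | 0 => X - 1
  | s + 1 => P γ s * (P γ s + C (r γ s))

/-- The integral `∫ f dν_s` of a function `f` against the normalized counting measure `ν_s`
on the `2^s` (simple, real) zeros of `P_{2^s} + r_s/2`. -/
noncomputable def nuInt (γ : ℕ → ℝ) (s : ℕ) (f : ℝ → ℝ) : ℝ :=
  (((P γ s + C (r γ s / 2)).roots.map f).sum) / 2 ^ s

/-- The Jacobi parameters `a_n = ‖Q_n‖ / ‖Q_{n-1}‖` (`n ≥ 1`), where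
`‖f‖ = (∫ f² dμ)^{1/2}`, together with the convention `a_0 = 0`. -/
noncomputable def jacobiA (μ : MeasureTheory.Measure ℝ) (Q : ℕ → Polynomial ℝ) : ℕ → ℝ
  | 0 => 0
  | n + 1 => Real.sqrt (∫ x, ((Q (n + 1)).eval x) ^ 2 ∂μ) /
      Real.sqrt (∫ x, ((Q n).eval x) ^ 2 ∂μ)

noncomputable def RR (γ : ℕ → ℝ) (s : ℕ) : Polynomial ℝ := P γ s + C (r γ s / 2)

noncomputable def cc (γ : ℕ → ℝ) (s : ℕ) : ℝ := (r γ s) ^ 2 / 4 - r γ (s + 1) / 2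

theorem RR_zero (γ : ℕ → ℝ) : RR γ 0 = X - C (1 / 2) := by
  have h : (1 : ℝ[X]) = C (1 / 2 : ℝ) + C (1 / 2 : ℝ) := by
    rw [← C_add]; norm_num
  simp only [RR, P, r]
  rw [h]; ring

theorem RR_succ (γ : ℕ → ℝ) (s : ℕ) : RR γ (s + 1) = (RR γ s) ^ 2 - C (cc γ s) := by
  have h : C (r γ s) = C (r γ s / 2) + C (r γ s / 2) := by
    rw [← C_add]; norm_num
  have h2 : C (cc γ s) = C (r γ s / 2) ^ 2 - C (r γ (s + 1) / 2) := by
    rw [← C_pow, ← C_sub]; congr 1; simp only [cc]; ring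
  rw [h2]
  simp only [RR, P]
  rw [h]; ring

theorem r_pos (γ : ℕ → ℝ) (hγ : ∀ s : ℕ, 0 < γ (s + 1) ∧ γ (s + 1) < 1 / 4) (s : ℕ) :
    0 < r γ s := by
  induction s with
  | zero => simp [r]
  | succ s ih => simp only [r]; have := (hγ s).1; positivity

theorem RR_monic (γ : ℕ → ℝ) (s : ℕ) : (RR γ s).Monic ∧ (RR γ s).natDegree = 2 ^ s := by
  induction s with
  | zero => rw [RR_zero]; exact ⟨monic_X_sub_C _, by simp⟩
  | succ s ih =>
    obtain ⟨h1, h2⟩ := ih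
    have hm : ((RR γ s) ^ 2).Monic := h1.pow 2
    have hd : ((RR γ s) ^ 2).natDegree = 2 ^ (s + 1) := by
      rw [h1.natDegree_pow, h2]; ring
    rw [RR_succ]
    refine ⟨?_, by rw [natDegree_sub_C, hd]⟩
    apply hm.sub_of_left
    apply lt_of_le_of_lt degree_C_le
    rw [degree_eq_natDegree hm.ne_zero, hd]
    exact_mod_cast (by positivity : 0 < 2 ^ (s + 1))

theorem sub_C_ne (γ : ℕ → ℝ) (s : ℕ) (y : ℝ) : RR γ s - C y ≠ 0 := by
  intro h
  have h1 := (RR_monic γ s).2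
  rw [sub_eq_zero.mp h, natDegree_C] at h1
  have : 0 < 2 ^ s := by positivity
  omega

theorem roots_succ (γ : ℕ → ℝ) (hγ : ∀ s : ℕ, 0 < γ (s + 1) ∧ γ (s + 1) < 1 / 4) (s : ℕ)
    (y : ℝ) (hy : |y| ≤ r γ (s + 1) / 2) : ∃ z : ℝ, |z| ≤ r γ s / 2 ∧ |-z| ≤ r γ s / 2 ∧
      (RR γ (s + 1) - C y).roots = (RR γ s - C z).roots + (RR γ s - C (-z)).roots := by
  have hr := r_pos γ hγ s
  have hc : r γ (s + 1) = γ (s + 1) * r γ s ^ 2 := rfl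
  have hle : r γ (s + 1) ≤ r γ s ^ 2 / 4 := by
    rw [hc]; nlinarith [(hγ s).2, sq_nonneg (r γ s)]
  obtain ⟨hy1, hy2⟩ := abs_le.mp hy
  have h0 : 0 ≤ cc γ s + y := by simp only [cc]; linarith
  have h1 : cc γ s + y ≤ (r γ s / 2) ^ 2 := by simp only [cc]; nlinarith
  have hz : |Real.sqrt (cc γ s + y)| ≤ r γ s / 2 := by
    rw [abs_of_nonneg (Real.sqrt_nonneg _)]
    exact (Real.sqrt_le_left (by positivity)).mpr h1
  refine ⟨Real.sqrt (cc γ s + y), hz, by rwa [abs_neg], ?_⟩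
  rw [← roots_mul (mul_ne_zero (sub_C_ne _ _ _) (sub_C_ne _ _ _))]
  congr 1
  have : C (cc γ s) + C y = C (Real.sqrt (cc γ s + y)) ^ 2 := by
    rw [← C_add, ← C_pow, Real.sq_sqrt h0]
  rw [RR_succ, C_neg]
  linear_combination -this

theorem roots_card (γ : ℕ → ℝ) (hγ : ∀ s : ℕ, 0 < γ (s + 1) ∧ γ (s + 1) < 1 / 4) (s : ℕ) :
    ∀ y : ℝ, |y| ≤ r γ s / 2 → Multiset.card (RR γ s - C y).roots = 2 ^ s := by
  induction s with
  | zero =>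
    intro y _
    rw [RR_zero, sub_sub, ← C_add, roots_X_sub_C]; simp
  | succ s ih =>
    intro y hy
    obtain ⟨z, h1, h2, h3⟩ := roots_succ γ hγ s y hy
    rw [h3, Multiset.card_add, ih _ h1, ih _ h2]; ring

theorem sum_self (γ : ℕ → ℝ) (hγ : ∀ s : ℕ, 0 < γ (s + 1) ∧ γ (s + 1) < 1 / 4) (s : ℕ)
    (f : ℝ → ℝ) (y : ℝ) (hy : |y| ≤ r γ s / 2) :
    ((RR γ s - C y).roots.map (fun x => f ((RR γ s).eval x))).sum = 2 ^ s * f y := by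
  rw [Multiset.map_congr rfl (g := fun _ => f y)]
  · rw [Multiset.map_const', Multiset.sum_replicate, roots_card γ hγ s y hy]; simp
  · intro x hx
    rw [mem_roots (sub_C_ne _ _ _), IsRoot.def, eval_sub, eval_C, sub_eq_zero] at hx
    rw [hx]

theorem sum_odd (γ : ℕ → ℝ) (hγ : ∀ s : ℕ, 0 < γ (s + 1) ∧ γ (s + 1) < 1 / 4) (s : ℕ)
    (f : ℝ → ℝ) (hf : ∀ x, f (-x) = - f x) (t : ℕ) : ∀ (y : ℝ), |y| ≤ r γ (s + 1 + t) / 2 →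
    ((RR γ (s + 1 + t) - C y).roots.map (fun x => f ((RR γ s).eval x))).sum = 0 := by
  induction t with
  | zero =>
    intro y hy
    obtain ⟨z, h1, h2, h3⟩ := roots_succ γ hγ s y hy
    rw [add_zero, h3, Multiset.map_add, Multiset.sum_add, sum_self γ hγ s f _ h1,
      sum_self γ hγ s f _ h2, hf]
    ring
  | succ t ih =>
    intro y hy
    obtain ⟨z, h1, h2, h3⟩ := roots_succ γ hγ (s + 1 + t) y hy
    rw [← add_assoc, h3, Multiset.map_add, Multiset.sum_add, ih _ h1, ih _ h2, add_zero]

theorem int_odd (γ : ℕ → ℝ) (hγ : ∀ s : ℕ, 0 < γ (s + 1) ∧ γ (s + 1) < 1 / 4)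
    (μ : Measure ℝ)
    (hμconv : ∀ p : Polynomial ℝ,
      Tendsto (fun s => nuInt γ s (fun x => p.eval x)) atTop (nhds (∫ x, p.eval x ∂μ)))
    (s : ℕ) (p : ℝ[X]) (hp : p.comp (-X) = -p) : ∫ x, (p.comp (RR γ s)).eval x ∂μ = 0 := by
  refine tendsto_nhds_unique (hμconv _) ?_
  apply tendsto_const_nhds.congr'
  filter_upwards [eventually_ge_atTop (s + 1)] with t ht
  obtain ⟨u, rfl⟩ := Nat.exists_eq_add_of_le ht
  have := sum_odd γ hγ s (fun x => p.eval x) (fun x => by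
    have := congrArg (eval x) hp
    simpa using this) u 0 (by
      rw [abs_zero]; have := r_pos γ hγ (s + 1 + u); positivity)
  simp only [C_0, sub_zero] at this
  simp only [nuInt, eval_comp]
  change 0 = Multiset.sum (Multiset.map _ (RR γ (s + 1 + u)).roots) / _
  rw [this, zero_div]

/-! Abstract orthogonal polynomials. -/

structure MOP (M : ℝ[X] →ₗ[ℝ] ℝ) (q : ℕ → ℝ[X]) : Prop where
  monic : ∀ n, (q n).Monic
  deg : ∀ n, (q n).natDegree = n
  orth : ∀ (n : ℕ) (p : ℝ[X]), p.degree < (n : WithBot ℕ) → M (q n * p) = 0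

def PosF (M : ℝ[X] →ₗ[ℝ] ℝ) : Prop := ∀ p : ℝ[X], p ≠ 0 → 0 < M (p * p)

def SymF (M : ℝ[X] →ₗ[ℝ] ℝ) : Prop := ∀ p : ℝ[X], p.comp (-X) = -p → M p = 0

theorem mop_exists (M : ℝ[X] →ₗ[ℝ] ℝ) (hM : PosF M) : ∃ q, MOP M q := by
  have key : ∀ n : ℕ, ∃ q : ℝ[X], q.Monic ∧ q.natDegree = n ∧
      ∀ p : ℝ[X], p.degree < (n : WithBot ℕ) → M (q * p) = 0 := by
    intro n
    let B : ℝ[X] →ₗ[ℝ] ℝ[X] →ₗ[ℝ] ℝ := (LinearMap.mul ℝ ℝ[X]).compr₂ M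
    let T : degreeLT ℝ n →ₗ[ℝ] Module.Dual ℝ (degreeLT ℝ n) :=
      B.compl₁₂ (degreeLT ℝ n).subtype (degreeLT ℝ n).subtype
    have : FiniteDimensional ℝ (degreeLT ℝ n) :=
      LinearEquiv.finiteDimensional (degreeLTEquiv ℝ n).symm
    have hinj : Function.Injective T := by
      rw [← LinearMap.ker_eq_bot, LinearMap.ker_eq_bot']
      intro u hu
      by_contra hne
      have h1 : T u u = 0 := by rw [hu]; rfl
      have h2 := hM (u : ℝ[X]) (by simpa using hne)
      exact absurd h1 h2.ne'
    have hsurj : Function.Surjective T :=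
      (LinearMap.injective_iff_surjective_of_finrank_eq_finrank
        (Subspace.dual_finrank_eq).symm).mp hinj
    obtain ⟨u, hu⟩ := hsurj ((B (X ^ n)).comp (degreeLT ℝ n).subtype)
    have hud : (u : ℝ[X]).degree < n := mem_degreeLT.mp u.2
    have hud' : (u : ℝ[X]).degree < (X ^ n : ℝ[X]).degree := by rwa [degree_X_pow]
    refine ⟨X ^ n - (u : ℝ[X]), (monic_X_pow n).sub_of_left hud', ?_, ?_⟩
    · apply natDegree_eq_of_degree_eq_some
      rw [degree_sub_eq_left_of_degree_lt hud', degree_X_pow]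
    · intro p hp
      have := LinearMap.congr_fun hu ⟨p, mem_degreeLT.mpr hp⟩
      change M ((u : ℝ[X]) * p) = M (X ^ n * p) at this
      rw [sub_mul, map_sub, this, sub_self]
  choose q h1 h2 h3 using key
  exact ⟨q, h1, h2, h3⟩

theorem deg_comp_lt {l f : ℝ[X]} {n : ℕ} (hl : l.natDegree = 1) (hf : f.degree < (n : WithBot ℕ)) :
    (f.comp l).degree < (n : WithBot ℕ) := by
  by_cases h0 : f = 0
  · subst h0; simpa using hf
  · refine degree_le_natDegree.trans_lt ?_
    rw [natDegree_comp, hl, mul_one]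
    rwa [degree_eq_natDegree h0] at hf

theorem monic_sub_deg {p q : ℝ[X]} {n : ℕ} (hp : p.Monic) (hq : q.Monic) (hpd : p.natDegree = n)
    (hqd : q.natDegree = n) : (p - q).degree < (n : WithBot ℕ) := by
  have := degree_sub_lt_left (p := p) (q := q) (by
    rw [degree_eq_natDegree hp.ne_zero, degree_eq_natDegree hq.ne_zero, hpd, hqd]) hp.ne_zero
    (by rw [hp.leadingCoeff, hq.leadingCoeff])
  rwa [degree_eq_natDegree hp.ne_zero, hpd] at this

theorem mop_unique {M : ℝ[X] →ₗ[ℝ] ℝ} (hM : PosF M) {q : ℕ → ℝ[X]} (hq : MOP M q) {n : ℕ}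
    {p : ℝ[X]} (h1 : p.Monic) (h2 : p.natDegree = n)
    (h3 : ∀ f : ℝ[X], f.degree < (n : WithBot ℕ) → M (p * f) = 0) : q n = p := by
  by_contra hne
  have hd := monic_sub_deg (hq.monic n) h1 (hq.deg n) h2
  have := hM (q n - p) (sub_ne_zero.mpr hne)
  rw [sub_mul, map_sub, hq.orth n _ hd, h3 _ hd] at this
  simp at this

/-- pairing with a polynomial of degree at most `n`. -/
theorem mop_coeff {M : ℝ[X] →ₗ[ℝ] ℝ} {q : ℕ → ℝ[X]} (hq : MOP M q) (n : ℕ) (p : ℝ[X])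
    (hp : p.degree ≤ (n : WithBot ℕ)) : M (q n * p) = p.coeff n * M (q n * q n) := by
  have hd : (p - C (p.coeff n) * q n).degree < (n : WithBot ℕ) := by
    rw [degree_lt_iff_coeff_zero]
    intro m hm
    rcases hm.eq_or_lt with rfl | hm
    · have : (q n).coeff n = 1 := by
        have := (hq.monic n).coeff_natDegree; rwa [hq.deg] at this
      simp [this]
    · rw [coeff_sub, coeff_C_mul, coeff_eq_zero_of_degree_lt (lt_of_le_of_lt hp (by exact_mod_cast hm)),
        coeff_eq_zero_of_natDegree_lt (p := q n) (by rwa [hq.deg])]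
      simp
  have := hq.orth n _ hd
  rw [mul_sub, map_sub, sub_eq_zero] at this
  rw [this, ← mul_assoc, mul_comm (q n), mul_assoc, ← smul_eq_C_mul, map_smul, smul_eq_mul]

theorem mop_parity {M : ℝ[X] →ₗ[ℝ] ℝ} (hM : PosF M) (hS : SymF M) {q : ℕ → ℝ[X]} (hq : MOP M q)
    (n : ℕ) : (q n).comp (-X) = (-1) ^ n * q n := by
  have hinv : ∀ p : ℝ[X], M (p.comp (-X)) = M p := by
    intro p
    rw [← sub_eq_zero, ← map_sub]
    apply hS
    rw [sub_comp, comp_assoc]; simp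
  have hdX : (-X : ℝ[X]).natDegree = 1 := by rw [natDegree_neg, natDegree_X]
  have hd : ((q n).comp (-X)).natDegree = n := by
    rw [natDegree_comp, hq.deg, hdX, mul_one]
  have hl : ((q n).comp (-X)).leadingCoeff = (-1) ^ n := by
    rw [leadingCoeff_comp (by rw [hdX]; norm_num), (hq.monic n).leadingCoeff, hq.deg]
    simp
  have h11 : ((-1 : ℝ[X]) ^ n) * (-1) ^ n = 1 := by
    rw [← mul_pow]; simp
  have hCC : ((-1 : ℝ[X]) ^ n) = C ((-1) ^ n) := by simp
  have := mop_unique hM hq (n := n) (p := (-1) ^ n * (q n).comp (-X)) ?_ ?_ ?_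
  · have e := congrArg (fun z => (-1) ^ n * z) this
    simp only [← mul_assoc, h11, one_mul] at e
    exact e.symm
  · rw [Monic, hCC, leadingCoeff_mul, hl, leadingCoeff_C, ← mul_pow]; simp
  · rw [hCC, natDegree_C_mul (by positivity), hd]
  · intro f hf
    rw [← hinv]
    have : ((-1) ^ n * (q n).comp (-X) * f).comp (-X) = q n * (C ((-1) ^ n) * f.comp (-X)) := by
      simp only [mul_comp, comp_assoc]; simp; ring
    rw [this]
    apply hq.orth
    rw [degree_C_mul (by positivity)]
    exact deg_comp_lt hdX hf

noncomputable def AA (M : ℝ[X] →ₗ[ℝ] ℝ) (q : ℕ → ℝ[X]) : ℕ → ℝ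
  | 0 => 0
  | n + 1 => M (q (n + 1) * q (n + 1)) / M (q n * q n)

theorem map_C_mul (M : ℝ[X] →ₗ[ℝ] ℝ) (a : ℝ) (p : ℝ[X]) : M (C a * p) = a * M p := by
  rw [← smul_eq_C_mul, map_smul, smul_eq_mul]

theorem mop_X_sq {M : ℝ[X] →ₗ[ℝ] ℝ} (hM : PosF M) (hS : SymF M) {q : ℕ → ℝ[X]} (hq : MOP M q)
    (n : ℕ) : M (X * (q n * q n)) = 0 := by
  apply hS
  rw [mul_comp, mul_comp, mop_parity hM hS hq, X_comp]
  have h11 : ((-1 : ℝ[X]) ^ n) * (-1) ^ n = 1 := by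
    rw [← mul_pow]; simp
  linear_combination (-X * (q n * q n)) * h11

/-- decomposition of a polynomial of degree at most `n` -/
theorem mop_decomp {M : ℝ[X] →ₗ[ℝ] ℝ} {q : ℕ → ℝ[X]} (hq : MOP M q) (n : ℕ) (f : ℝ[X])
    (hf : f.degree < ((n + 1 : ℕ) : WithBot ℕ)) :
    ∃ (a : ℝ) (g : ℝ[X]), g.degree < (n : WithBot ℕ) ∧ f = C a * q n + g := by
  refine ⟨f.coeff n, f - C (f.coeff n) * q n, ?_, by ring⟩
  rw [degree_lt_iff_coeff_zero] at hf ⊢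
  intro m hm
  rcases hm.eq_or_lt with rfl | hm
  · have : (q n).coeff n = 1 := by
      have := (hq.monic n).coeff_natDegree; rwa [hq.deg] at this
    simp [this]
  · rw [coeff_sub, coeff_C_mul, hf m hm,
      coeff_eq_zero_of_natDegree_lt (p := q n) (by rwa [hq.deg])]
    simp

theorem X_mul_deg {g : ℝ[X]} {n : ℕ} (hg : g.degree < (n : WithBot ℕ)) :
    (X * g).degree ≤ (n : WithBot ℕ) := by
  rw [degree_lt_iff_coeff_zero] at hg
  rw [degree_le_iff_coeff_zero]
  intro m hm
  have hm' : n < m := by exact_mod_cast hm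
  obtain ⟨k, rfl⟩ : ∃ k, m = k + 1 := ⟨m - 1, by omega⟩
  rw [coeff_X_mul]
  exact hg k (by omega)

theorem X_mul_monic {M : ℝ[X] →ₗ[ℝ] ℝ} {q : ℕ → ℝ[X]} (hq : MOP M q) (n : ℕ) :
    (X * q n).Monic ∧ (X * q n).natDegree = n + 1 := by
  refine ⟨monic_X.mul (hq.monic n), ?_⟩
  rw [monic_X.natDegree_mul (hq.monic n), natDegree_X, hq.deg, add_comm]

theorem mop_norm {M : ℝ[X] →ₗ[ℝ] ℝ} (hM : PosF M) (hS : SymF M) {q : ℕ → ℝ[X]} (hq : MOP M q)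
    (n : ℕ) : M ((X * q n) * (X * q n)) =
      M (q (n + 1) * q (n + 1)) + AA M q n * M (q n * q n) := by
  obtain ⟨hXm, hXd⟩ := X_mul_monic hq n
  cases n with
  | zero =>
    have : q 1 = X * q 0 := by
      apply mop_unique hM hq hXm hXd
      intro f hf
      obtain ⟨a, g, hg, rfl⟩ := mop_decomp hq 0 f hf
      have hg0 : g = 0 := by
        rw [← degree_eq_bot]
        have := hg
        rw [Nat.cast_zero] at this
        simpa using this
      rw [hg0, add_zero, show X * q 0 * (C a * q 0) = C a * (X * (q 0 * q 0)) by ring, map_C_mul,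
        mop_X_sq hM hS hq, mul_zero]
    rw [zero_add, this]; simp [AA]
  | succ m =>
    have hpos := hM (q m) (hq.monic m).ne_zero
    have hqd : ∀ k, (q k).degree = (k : WithBot ℕ) := fun k => by
      rw [degree_eq_natDegree (hq.monic k).ne_zero, hq.deg]
    have hA : AA M q (m + 1) * M (q m * q m) = M (q (m + 1) * q (m + 1)) := by
      simp only [AA]; field_simp
    set A := AA M q (m + 1) with hAdef
    have hlow : (C A * q m).degree < (X * q (m + 1)).degree := by
      refine lt_of_le_of_lt ((smul_eq_C_mul A (p := q m)) ▸ degree_smul_le A (q m)) ?_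
      rw [degree_eq_natDegree hXm.ne_zero, hXd, hqd]
      exact_mod_cast (by omega : m < m + 1 + 1)
    have h3 : q (m + 1 + 1) = X * q (m + 1) - C A * q m := by
      apply mop_unique hM hq (hXm.sub_of_left hlow)
      · apply natDegree_eq_of_degree_eq_some
        rw [degree_sub_eq_left_of_degree_lt hlow, degree_eq_natDegree hXm.ne_zero, hXd]
      · intro f hf
        obtain ⟨a, g, hg, rfl⟩ := mop_decomp hq (m + 1) f hf
        have e : (X * q (m + 1) - C A * q m) * (C a * q (m + 1) + g) =
          C a * (X * (q (m + 1) * q (m + 1))) + q (m + 1) * (X * g)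
          - C (A * a) * (q (m + 1) * q m) - C A * (q m * g) := by
          rw [C_mul]; ring
        have hgm : g.degree ≤ (m : WithBot ℕ) := by
          rw [degree_lt_iff_coeff_zero] at hg
          rw [degree_le_iff_coeff_zero]
          intro k hk
          exact hg k (by have : m < k := by exact_mod_cast hk
                         omega)
        rw [e, map_sub, map_sub, map_add, map_C_mul, map_C_mul, map_C_mul, mop_X_sq hM hS hq,
          mop_coeff hq (m + 1) _ (X_mul_deg hg), coeff_X_mul, mop_coeff hq m g hgm,
          hq.orth (m + 1) (q m) (by rw [hqd]; exact_mod_cast Nat.lt_succ_self m)]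
        linear_combination (-g.coeff m) * hA
    have h4 : X * q (m + 1) = q (m + 1 + 1) + C A * q m := by rw [h3]; ring
    have e : (q (m + 1 + 1) + C A * q m) * (q (m + 1 + 1) + C A * q m) =
      q (m + 1 + 1) * q (m + 1 + 1) + C (2 * A) * (q (m + 1 + 1) * q m)
        + C (A * A) * (q m * q m) := by
      rw [C_mul, C_mul, C_ofNat]; ring
    rw [h4, e, map_add, map_add, map_C_mul, map_C_mul,
      hq.orth (m + 1 + 1) (q m) (by rw [hqd]; exact_mod_cast (by omega : m < m + 1 + 1))]
    linear_combination A * hA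

theorem mop_even {M N : ℝ[X] →ₗ[ℝ] ℝ} (hM : PosF M) (hS : SymF M) {q g : ℕ → ℝ[X]}
    (hq : MOP M q) (hg : MOP N g) (c : ℝ) (hN : ∀ p, N p = M (p.comp (X ^ 2 - C c))) (k : ℕ) :
    q (2 * k) = (g k).comp (X ^ 2 - C c) := by
  have hd : (X ^ 2 - C c : ℝ[X]).natDegree = 2 := natDegree_X_pow_sub_C
  have hm : (X ^ 2 - C c : ℝ[X]).Monic := monic_X_pow_sub_C c (by norm_num)
  apply mop_unique hM hq
  · exact (hg.monic k).comp hm (by rw [hd]; norm_num)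
  · rw [natDegree_comp, hd, hg.deg, mul_comm]
  · intro f hf
    by_cases hf0 : f = 0
    · simp [hf0]
    have hfn : f.natDegree < 2 * k := (natDegree_lt_iff_degree_lt hf0).mpr hf
    rw [f.as_sum_range' (2 * k) hfn, Finset.mul_sum, map_sum]
    apply Finset.sum_eq_zero
    intro i hi
    rw [Finset.mem_range] at hi
    rw [← C_mul_X_pow_eq_monomial,
      show (g k).comp (X ^ 2 - C c) * (C (f.coeff i) * X ^ i) =
        C (f.coeff i) * ((g k).comp (X ^ 2 - C c) * X ^ i) by ring, map_C_mul]
    rcases Nat.even_or_odd' i with ⟨j, rfl | rfl⟩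
    · have : (g k).comp (X ^ 2 - C c) * X ^ (2 * j) =
          (g k * (X + C c) ^ j).comp (X ^ 2 - C c) := by
        rw [mul_comp, pow_comp, add_comp, X_comp, C_comp, sub_add_cancel, ← pow_mul]
      rw [this, ← hN, hg.orth, mul_zero]
      rw [degree_pow, degree_X_add_C]
      simp only [nsmul_eq_mul, mul_one]
      exact_mod_cast (by omega : j < k)
    · rw [hS, mul_zero]
      rw [mul_comp, comp_assoc]
      simp [pow_succ, pow_mul]

theorem mop_rel {M N : ℝ[X] →ₗ[ℝ] ℝ} (hM : PosF M) (hS : SymF M) (hNp : PosF N) (hNS : SymF N)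
    {q g : ℕ → ℝ[X]}
    (hq : MOP M q) (hg : MOP N g) (c : ℝ) (hN : ∀ p, N p = M (p.comp (X ^ 2 - C c))) (k : ℕ) :
    AA M q (2 * k) + AA M q (2 * k + 1) = c ∧
    AA M q (2 * k + 1) * AA M q (2 * k + 2) = AA N g (k + 1) := by
  have hev : ∀ k, M (q (2 * k) * q (2 * k)) = N (g k * g k) := by
    intro k
    rw [mop_even hM hS hq hg c hN k, hN, mul_comp]
  have hp : ∀ n, 0 < M (q n * q n) := fun n => hM _ (hq.monic n).ne_zero
  constructor
  · have h1 := mop_norm hM hS hq (2 * k)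
    have h2 : M (X * q (2 * k) * (X * q (2 * k))) = c * M (q (2 * k) * q (2 * k)) := by
      have e : X * q (2 * k) * (X * q (2 * k)) =
          (X * (g k * g k) + C c * (g k * g k)).comp (X ^ 2 - C c) := by
        rw [mop_even hM hS hq hg c hN k]
        simp only [add_comp, mul_comp, X_comp, C_comp]; ring
      rw [e, ← hN, map_add, mop_X_sq hNp hNS hg, map_C_mul, hev]; ring
    have h3 : AA M q (2 * k + 1) * M (q (2 * k) * q (2 * k)) =
        M (q (2 * k + 1) * q (2 * k + 1)) := by
      simp only [AA]; have := hp (2 * k); field_simp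
    have h4 := hp (2 * k)
    apply mul_right_cancel₀ h4.ne'
    linear_combination h3 - h1 + h2
  · have e1 := hev k
    have e2 := hev (k + 1)
    rw [show 2 * (k + 1) = 2 * k + 1 + 1 by ring] at e2
    simp only [AA]
    rw [← e1, ← e2]
    have := hp (2 * k)
    have := hp (2 * k + 1)
    field_simp

theorem real_rec (A : ℕ → ℕ → ℝ) (c : ℕ → ℝ) (h0 : ∀ t, A t 0 = 0) (hp : ∀ t n, 0 ≤ A t n)
    (hc : ∀ t, 0 < c t) (hcc : ∀ t, c (t + 1) ≤ c t ^ 2 / 4)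
    (hs : ∀ t k, A t (2 * k) + A t (2 * k + 1) = c t)
    (hm : ∀ t k, A t (2 * k + 1) * A t (2 * k + 2) = A (t + 1) (k + 1)) :
    (∀ t n, A t n ≤ c t) ∧ ∀ n t j, 1 ≤ j →
      Tendsto (fun s => A t (j * 2 ^ s + n)) atTop (nhds (A t n)) := by
  have hle : ∀ t n, A t n ≤ c t := by
    intro t n
    rcases Nat.even_or_odd' n with ⟨k, rfl | rfl⟩
    · linarith [hs t k, hp t (2 * k + 1)]
    · linarith [hs t k, hp t (2 * k)]
  have heven : ∀ t k, A t (2 * k) ≤ c t / 2 := by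
    intro t k
    induction k with
    | zero => rw [mul_zero, h0]; linarith [hc t]
    | succ k ih =>
      by_contra hcon
      push Not at hcon
      rw [show 2 * (k + 1) = 2 * k + 2 by ring] at hcon
      have h1 : c t / 2 ≤ A t (2 * k + 1) := by linarith [hs t k]
      have h2 := hm t k
      have h3 := hle (t + 1) (k + 1)
      have h4 := hcc t
      have h5 := hc t
      nlinarith
  have hodd : ∀ t k, c t / 2 ≤ A t (2 * k + 1) := by
    intro t k
    linarith [hs t k, heven t k]
  have hpow : ∀ m t j, 1 ≤ j → A t (j * 2 ^ m) ≤ c t / 2 ^ m := by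
    intro m
    induction m with
    | zero => intro t j _; simpa using hle t j
    | succ m ih =>
      intro t j hj
      have hpos : 0 < j * 2 ^ m := by positivity
      obtain ⟨k, hk⟩ : ∃ k, j * 2 ^ m = k + 1 := ⟨j * 2 ^ m - 1, by omega⟩
      have h1 := ih (t + 1) j hj
      rw [show j * 2 ^ (m + 1) = 2 * k + 2 by rw [pow_succ, ← mul_assoc, hk]; ring]
      rw [hk] at h1
      have h2 := hm t k
      have h3 := hodd t k
      have h4 : c (t + 1) / 2 ^ m ≤ c t ^ 2 / 4 / 2 ^ m := by
        gcongr; exact hcc t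
      have h5 := hc t
      have h6 := hp t (2 * k + 2)
      have h7 : c t / 2 * A t (2 * k + 2) ≤ c t / 2 * (c t / 2 ^ (m + 1)) := by
        calc c t / 2 * A t (2 * k + 2) ≤ A t (2 * k + 1) * A t (2 * k + 2) := by gcongr
          _ ≤ c t ^ 2 / 4 / 2 ^ m := by linarith
          _ = c t / 2 * (c t / 2 ^ (m + 1)) := by field_simp; ring
      exact le_of_mul_le_mul_left h7 (by positivity)
  refine ⟨hle, ?_⟩
  intro n
  induction n using Nat.strong_induction_on with
  | _ n ih =>
    intro t j hj
    rcases Nat.even_or_odd' n with ⟨k, rfl | rfl⟩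
    · cases k with
      | zero =>
        simp only [mul_zero, add_zero, h0]
        refine squeeze_zero (fun s => hp _ _) (fun s => hpow s t j hj) ?_
        have : Tendsto (fun s : ℕ => c t * (1 / 2 : ℝ) ^ s) atTop (nhds (c t * 0)) :=
          (tendsto_pow_atTop_nhds_zero_of_lt_one (by norm_num) (by norm_num)).const_mul _
        simpa [div_eq_mul_inv] using this
      | succ k =>
        rw [← tendsto_add_atTop_iff_nat 1]
        have h1 := ih (k + 1) (by omega) (t + 1) j hj
        have h2 := (tendsto_add_atTop_iff_nat 1).mpr (ih (2 * k + 1) (by omega) t j hj)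
        have hne : ∀ k, A t (2 * k + 1) ≠ 0 := fun k => by
          have := hodd t k; have := hc t; intro h; linarith
        have h3 := h1.div h2 (hne k)
        rw [← hm t k, mul_div_cancel_left₀ _ (hne k)] at h3
        refine h3.congr (fun s => ?_)
        have e1 : j * 2 ^ (s + 1) + (2 * k + 1) = 2 * (j * 2 ^ s + k) + 1 := by
          rw [pow_succ]; ring
        have e2 : j * 2 ^ (s + 1) + 2 * (k + 1) = 2 * (j * 2 ^ s + k) + 2 := by
          rw [pow_succ]; ring
        simp only [Pi.div_apply]
        rw [e1, e2, ← add_assoc, ← hm, mul_div_cancel_left₀ _ (hne _)]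
    · rw [← tendsto_add_atTop_iff_nat 1]
      have h1 := (tendsto_add_atTop_iff_nat 1).mpr (ih (2 * k) (by omega) t j hj)
      have h2 := h1.const_sub (c t)
      rw [← hs t k, add_sub_cancel_left] at h2
      refine h2.congr (fun s => ?_)
      have e1 : j * 2 ^ (s + 1) + (2 * k + 1) = 2 * (j * 2 ^ s + k) + 1 := by
        rw [pow_succ]; ring
      have e2 : j * 2 ^ (s + 1) + 2 * k = 2 * (j * 2 ^ s + k) := by
        rw [pow_succ]; ring
      rw [e1, e2, hs t k]
      linarith [hs t (j * 2 ^ s + k)]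

theorem cc_facts (γ : ℕ → ℝ) (hγ : ∀ s : ℕ, 0 < γ (s + 1) ∧ γ (s + 1) < 1 / 4)
    (hγ6 : ∀ s : ℕ, γ (s + 1) ≤ 1 / 6) (s : ℕ) :
    0 < cc γ s ∧ cc γ (s + 1) ≤ cc γ s ^ 2 / 4 := by
  have hr := r_pos γ hγ s
  have hr1 := r_pos γ hγ (s + 1)
  have hr2 := r_pos γ hγ (s + 2)
  have h := hγ s
  have h6 := hγ6 s
  have e : cc γ s = r γ s ^ 2 * ((1 - 2 * γ (s + 1)) / 4) := by
    simp only [cc, r]; ring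
  constructor
  · rw [e]; have : 0 < 1 - 2 * γ (s + 1) := by linarith
    positivity
  · have h1 : cc γ (s + 1) ≤ r γ (s + 1) ^ 2 / 4 := by
      simp only [cc]; linarith
    refine h1.trans ?_
    have h2 : r γ (s + 1) ≤ cc γ s := by
      rw [e]; change γ (s + 1) * r γ s ^ 2 ≤ _
      rw [mul_comm]; gcongr; linarith
    gcongr

theorem stmt_17 (γ : ℕ → ℝ) (hγ : ∀ s : ℕ, 0 < γ (s + 1) ∧ γ (s + 1) < 1 / 4)
    (μ : Measure ℝ) [IsProbabilityMeasure μ]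
    (hμint : ∀ p : Polynomial ℝ, Integrable (fun x => p.eval x) μ)
    (hμpos : ∀ p : Polynomial ℝ, p ≠ 0 → 0 < ∫ x, (p.eval x) ^ 2 ∂μ)
    (hμconv : ∀ p : Polynomial ℝ,
      Tendsto (fun s => nuInt γ s (fun x => p.eval x)) atTop (nhds (∫ x, p.eval x ∂μ)))
    (Q : ℕ → Polynomial ℝ) (hQmonic : ∀ n, (Q n).Monic) (hQdeg : ∀ n, (Q n).natDegree = n)
    (hQorth : ∀ n : ℕ, ∀ p : Polynomial ℝ, p.degree < (n : WithBot ℕ) →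
      ∫ x, (Q n).eval x * p.eval x ∂μ = 0)
    (hγ6 : ∀ s : ℕ, γ (s + 1) ≤ 1 / 6) :
    (∀ j n : ℕ, 1 ≤ j →
      Tendsto (fun s => jacobiA μ Q (j * 2 ^ s + n)) atTop (nhds (jacobiA μ Q n))) ∧
    (∀ j : ℕ, 1 ≤ j → Tendsto (fun s => jacobiA μ Q (j * 2 ^ s)) atTop (nhds 0)) ∧
    Filter.liminf (fun n => jacobiA μ Q n) Filter.atTop = 0 := by
  obtain ⟨M, hMdef⟩ : ∃ M : ℕ → ℝ[X] →ₗ[ℝ] ℝ, ∀ s p,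
      M s p = ∫ x, (p.comp (RR γ s)).eval x ∂μ := by
    refine ⟨fun s =>
      { toFun := fun p => ∫ x, (p.comp (RR γ s)).eval x ∂μ
        map_add' := ?_
        map_smul' := ?_ }, fun _ _ => rfl⟩
    · intro p q
      simp only [add_comp, eval_add]
      exact integral_add (hμint _) (hμint _)
    · intro a p
      simp only [smul_comp, eval_smul, RingHom.id_apply]
      exact integral_smul _ _
  have hMpos : ∀ s, PosF (M s) := by
    intro s p hp
    rw [hMdef]
    have h1 : p.comp (RR γ s) ≠ 0 := by
      intro h
      rcases comp_eq_zero_iff.mp h with h | ⟨_, h⟩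
      · exact hp h
      · exact sub_C_ne γ s ((RR γ s).coeff 0) (sub_eq_zero.mpr h)
    have := hμpos _ h1
    simpa only [mul_comp, eval_mul, pow_two] using this
  have hMsym : ∀ s, SymF (M s) := by
    intro s p hp
    rw [hMdef]
    exact int_odd γ hγ μ hμconv s p hp
  have hMM : ∀ s p, M (s + 1) p = M s (p.comp (X ^ 2 - C (cc γ s))) := by
    intro s p
    rw [hMdef, hMdef, comp_assoc, RR_succ]
    simp
  choose g hg using fun s => mop_exists (M s) (hMpos s)
  have hQ0 : ∀ n, g 0 n = (Q n).comp (X + C (1 / 2)) := by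
    intro n
    have hd : (X + C (1 / 2) : ℝ[X]).natDegree = 1 := natDegree_X_add_C _
    apply mop_unique (hMpos 0) (hg 0)
    · exact (hQmonic n).comp (monic_X_add_C _) (by rw [hd]; norm_num)
    · rw [natDegree_comp, hd, hQdeg, mul_one]
    · intro f hf
      rw [hMdef, RR_zero, mul_comp, comp_assoc]
      have := hQorth n (f.comp (X - C (1 / 2))) (deg_comp_lt (natDegree_X_sub_C _) hf)
      simpa only [add_comp, X_comp, C_comp, sub_add_cancel, comp_X, eval_mul] using this
  have hnorm : ∀ n, M 0 (g 0 n * g 0 n) = ∫ x, ((Q n).eval x) ^ 2 ∂μ := by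
    intro n
    rw [hMdef, hQ0, RR_zero, mul_comp, comp_assoc]
    simp only [add_comp, X_comp, C_comp, sub_add_cancel, comp_X, eval_mul, pow_two]
  have hjac : ∀ n, jacobiA μ Q n = Real.sqrt (AA (M 0) (g 0) n) := by
    intro n
    cases n with
    | zero => simp [jacobiA, AA]
    | succ n =>
      simp only [jacobiA, AA]
      rw [hnorm, hnorm, Real.sqrt_div]
      exact integral_nonneg (fun x => sq_nonneg _)
  have hrel := fun t k => mop_rel (hMpos t) (hMsym t) (hMpos (t + 1)) (hMsym (t + 1)) (hg t)
    (hg (t + 1)) (cc γ t) (hMM t) k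
  obtain ⟨hbd, hlim⟩ := real_rec (fun t n => AA (M t) (g t) n) (cc γ) (fun t => rfl)
    (fun t n => by
      cases n with
      | zero => exact le_refl _
      | succ n =>
        exact div_nonneg (hMpos t _ ((hg t).monic _).ne_zero).le
          (hMpos t _ ((hg t).monic _).ne_zero).le)
    (fun t => (cc_facts γ hγ hγ6 t).1) (fun t => (cc_facts γ hγ hγ6 t).2)
    (fun t k => (hrel t k).1) (fun t k => (hrel t k).2)
  have main : ∀ j n : ℕ, 1 ≤ j →
      Tendsto (fun s => jacobiA μ Q (j * 2 ^ s + n)) atTop (nhds (jacobiA μ Q n)) := by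
    intro j n hj
    simp only [hjac]
    exact (hlim n 0 j hj).sqrt
  have main0 : ∀ j : ℕ, 1 ≤ j → Tendsto (fun s => jacobiA μ Q (j * 2 ^ s)) atTop (nhds 0) :=
    fun j hj => main j 0 hj
  refine ⟨main, main0, ?_⟩
  have hnn : ∀ n, 0 ≤ jacobiA μ Q n := fun n => by rw [hjac]; exact Real.sqrt_nonneg _
  have hub : ∀ n, jacobiA μ Q n ≤ Real.sqrt (cc γ 0) := fun n => by
    rw [hjac]; exact Real.sqrt_le_sqrt (hbd 0 n)
  have hbb : IsBoundedUnder (· ≥ ·) atTop (fun n => jacobiA μ Q n) :=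
    isBoundedUnder_of ⟨0, hnn⟩
  have hba : IsBoundedUnder (· ≤ ·) atTop (fun n => jacobiA μ Q n) :=
    isBoundedUnder_of ⟨_, hub⟩
  apply le_antisymm
  · apply le_of_forall_pos_le_add
    intro ε hε
    rw [zero_add]
    refine liminf_le_of_frequently_le ?_ hbb
    have h1 : ∀ᶠ s in atTop, jacobiA μ Q (1 * 2 ^ s) ≤ ε :=
      ((main0 1 le_rfl).eventually (gt_mem_nhds hε)).mono (fun _ h => le_of_lt h)
    have h2 : Tendsto (fun s : ℕ => 1 * 2 ^ s) atTop atTop := by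
      simpa using tendsto_pow_atTop_atTop_of_one_lt (by norm_num : 1 < 2)
    exact h2.frequently h1.frequently
  · exact le_liminf_of_le hba.isCoboundedUnder_ge (Eventually.of_forall hnn)
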